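/- Let w and y be distinct extreme points of P with a₁ · w = b₁ (w lies on the foot F₁), a₁ · y < b₁ (y does not lie on F₁), and aₙ · w = bₙ and aₙ · y = bₙ (both lie on the facet G = Fₙ). Suppose the closed segment [w, y] is an edge of P, and suppose that, with J = {i : 2 ≤ i ≤ n − 1, aᵢ · w = bᵢ and aᵢ · y = bᵢ}, the set {z ∈ ℝ^d : aᵢ · z = bᵢ for all i ∈ J} equals the affine line through w and y (i.e., the supporting line of this nonsimple edge is pinned by facets other than G). Then there exists ε₀ > 0 such that for all 0 < ε < ε₀, the closed segment joining (w, 0) and (y, 0) is an edge of the perturbed wedge W_ε. -/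

import Mathlib

/-!
STATEMENT 7: a nonsimple edge `[w, y]` of `P` lying in the perturbed facet
`G = Fₙ`, with `w` on the foot `F₁` and `y` off it, whose supporting line is
pinned by facets other than `G`, survives the perturbation: for all small
`ε > 0` the segment `[(w, 0), (y, 0)]` is an edge of the perturbed wedge `W_ε`.
-/

open scoped RealInnerProductSpace

noncomputable section

abbrev Euc (d : ℕ) := EuclideanSpace ℝ (Fin d)

/-- A face of a compact convex set `C` is `C` itself or an exposed face of `C`:
the set of points of `C` maximizing some linear functional. -/
def IsFaceOf {V : Type*} [AddCommGroup V] [Module ℝ V] (C F : Set V) : Prop :=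
  F = C ∨ ∃ l : V →ₗ[ℝ] ℝ, F = {x ∈ C | ∀ y ∈ C, l y ≤ l x}

/-- An edge of `C` is a face whose affine span has dimension `1`. -/
def IsEdgeOf {V : Type*} [AddCommGroup V] [Module ℝ V] (C F : Set V) : Prop :=
  IsFaceOf C F ∧ Module.finrank ℝ (affineSpan ℝ F).direction = 1

theorem perturbedWedge_preserves_nonsimple_edge_to_foot
    (d n : ℕ) (hd : 2 ≤ d) (hn : 3 ≤ n)
    (a : ℕ → Euc d) (b : ℕ → ℝ)
    (P : Set (Euc d))
    (hP : P = {z : Euc d | ∀ i, 1 ≤ i → i ≤ n → ⟪a i, z⟫ ≤ b i})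
    (hPcompact : IsCompact P)
    (hPint : (interior P).Nonempty)
    (hfacets : ∀ i, 1 ≤ i → i ≤ n →
      Module.finrank ℝ (affineSpan ℝ {z ∈ P | ⟪a i, z⟫ = b i}).direction = d - 1)
    (w y : Euc d) (hwy : w ≠ y)
    (hw : w ∈ Set.extremePoints ℝ P) (hy : y ∈ Set.extremePoints ℝ P)
    (hw1 : ⟪a 1, w⟫ = b 1) (hy1 : ⟪a 1, y⟫ < b 1)
    (hwn : ⟪a n, w⟫ = b n) (hyn : ⟪a n, y⟫ = b n)
    (hedge : IsEdgeOf P (segment ℝ w y))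
    (J : Set ℕ)
    (hJ : J = {i | 2 ≤ i ∧ i ≤ n - 1 ∧ ⟪a i, w⟫ = b i ∧ ⟪a i, y⟫ = b i})
    (hpinned : {z : Euc d | ∀ i ∈ J, ⟪a i, z⟫ = b i} =
      (affineSpan ℝ ({w, y} : Set (Euc d)) : Set (Euc d))) :
    ∃ ε₀ > (0 : ℝ), ∀ ε : ℝ, 0 < ε → ε < ε₀ →
      IsEdgeOf
        {p : Euc d × ℝ | ⟪a 1, p.1⟫ + p.2 ≤ b 1 ∧ ⟪a 1, p.1⟫ - p.2 ≤ b 1 ∧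
          (∀ i, 2 ≤ i → i ≤ n - 1 → ⟪a i, p.1⟫ ≤ b i) ∧
          ⟪a n, p.1⟫ + ε * p.2 ≤ b n}
        (segment ℝ ((w, (0 : ℝ)) : Euc d × ℝ) ((y, (0 : ℝ)) : Euc d × ℝ)) := by
  classical
  refine ⟨1, one_pos, fun ε hε _ => ⟨Or.inr ?_, ?_⟩⟩
  · have hwP : ∀ i, 1 ≤ i → i ≤ n → ⟪a i, w⟫ ≤ b i := by
      have h := hw.1
      rw [hP] at h
      exact h
    have hyP : ∀ i, 1 ≤ i → i ≤ n → ⟪a i, y⟫ ≤ b i := by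
      have h := hy.1
      rw [hP] at h
      exact h
    let S : Finset ℕ := (Finset.Icc 2 (n - 1)).filter (fun i => i ∈ J)
    have hS : ∀ i, i ∈ S ↔ i ∈ J := by
      intro i
      simp only [S, Finset.mem_filter, Finset.mem_Icc, hJ, Set.mem_ofPred_eq]
      tauto
    let l : (Euc d × ℝ) →ₗ[ℝ] ℝ :=
      (∑ i ∈ S, (innerₛₗ ℝ (a i)) ∘ₗ LinearMap.fst ℝ (Euc d) ℝ) +
        ((innerₛₗ ℝ (a n)) ∘ₗ LinearMap.fst ℝ (Euc d) ℝ + ε • LinearMap.snd ℝ (Euc d) ℝ)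
    have hl : ∀ p : Euc d × ℝ, l p = ∑ i ∈ S, ⟪a i, p.1⟫ + (⟪a n, p.1⟫ + ε * p.2) := by
      intro p
      simp [l, LinearMap.sum_apply]
    have hJ2 : ∀ i ∈ S, 2 ≤ i ∧ i ≤ n - 1 ∧ ⟪a i, w⟫ = b i ∧ ⟪a i, y⟫ = b i := by
      intro i hi
      have := (hS i).1 hi
      rw [hJ] at this
      exact this
    refine ⟨l, ?_⟩
    ext ⟨z, t⟩
    constructor
    · rintro ⟨u, v, hu, hv, huv, h⟩
      simp only [Prod.smul_mk, Prod.mk_add_mk, Prod.mk.injEq, smul_zero, add_zero] at h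
      obtain ⟨rfl, rfl⟩ := h
      have key : ∀ i, ⟪a i, u • w + v • y⟫ = u * ⟪a i, w⟫ + v * ⟪a i, y⟫ := by
        intro i
        rw [inner_add_right, inner_smul_right, inner_smul_right]
      have hle : ∀ i, 1 ≤ i → i ≤ n → ⟪a i, u • w + v • y⟫ ≤ b i := by
        intro i h1 h2
        rw [key]
        have e : b i = u * b i + v * b i := by rw [← add_mul, huv, one_mul]
        rw [e]
        exact add_le_add (mul_le_mul_of_nonneg_left (hwP i h1 h2) hu)
          (mul_le_mul_of_nonneg_left (hyP i h1 h2) hv)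
      refine ⟨⟨?_, ?_, ?_, ?_⟩, ?_⟩
      · simpa using hle 1 le_rfl (by omega)
      · simpa using hle 1 le_rfl (by omega)
      · intro i h1 h2
        exact hle i (by omega) (by omega)
      · simpa using hle n (by omega) le_rfl
      · rintro p ⟨-, -, hp3, hp4⟩
        rw [hl, hl]
        refine add_le_add (Finset.sum_le_sum fun i hi => ?_) ?_
        · obtain ⟨h1, h2, h3, h4⟩ := hJ2 i hi
          change _ ≤ ⟪a i, u • w + v • y⟫
          rw [key, h3, h4, ← add_mul, huv, one_mul]
          exact hp3 i h1 h2
        · change _ ≤ ⟪a n, u • w + v • y⟫ + ε * 0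
          rw [key, hwn, hyn, ← add_mul, huv, one_mul, mul_zero, add_zero]
          exact hp4
    · rintro ⟨⟨h1, h2, h3, h4⟩, hmax⟩
      dsimp only at h1 h2 h3 h4
      have hm := hmax (w, 0) ⟨by simp [hw1], by simp [hw1],
        fun i h1 h2 => hwP i (by omega) (by omega), by simp [hwn]⟩
      rw [hl, hl] at hm
      dsimp only at hm
      have hle : ∀ i ∈ S, ⟪a i, z⟫ ≤ ⟪a i, w⟫ := by
        intro i hi
        obtain ⟨k1, k2, k3, k4⟩ := hJ2 i hi
        rw [k3]
        exact h3 i k1 k2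
      have hsum := Finset.sum_le_sum hle
      have heq : ∀ i ∈ S, ⟪a i, z⟫ = ⟪a i, w⟫ :=
        (Finset.sum_eq_sum_iff_of_le hle).1 (by linarith)
      have hline : z ∈ (affineSpan ℝ ({w, y} : Set (Euc d)) : Set (Euc d)) := by
        rw [← hpinned]
        intro i hi
        have hi' := (hS i).2 hi
        rw [heq i hi', (hJ2 i hi').2.2.1]
      obtain ⟨s, hz⟩ := mem_affineSpan_pair_iff_exists_lineMap_eq.1 hline
      rw [AffineMap.lineMap_apply_module] at hz
      subst hz
      have hn' : ⟪a n, (1 - s) • w + s • y⟫ = b n := by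
        rw [inner_add_right, inner_smul_right, inner_smul_right, hwn, hyn]
        ring
      have ht : t = 0 := by
        have : ε * t = 0 := by linarith
        exact (mul_eq_zero.1 this).resolve_left hε.ne'
      subst ht
      have hzP : (1 - s) • w + s • y ∈ P := by
        rw [hP]
        intro i k1 k2
        rcases Nat.lt_or_ge i 2 with h | h
        · obtain rfl : i = 1 := by omega
          linarith
        · rcases Nat.lt_or_ge i n with h' | h'
          · exact h3 i h (by omega)
          · obtain rfl : i = n := by omega
            linarith
      have hs0 : 0 ≤ s := by
        rw [inner_add_right, inner_smul_right, inner_smul_right, hw1] at h1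
        by_contra hs
        push Not at hs
        nlinarith
      have hs1 : s ≤ 1 := by
        by_contra hs
        push Not at hs
        have hspos : 0 < s := by linarith
        have hmem : y ∈ openSegment ℝ w ((1 - s) • w + s • y) := by
          refine ⟨1 - s⁻¹, s⁻¹, by have := inv_lt_one_of_one_lt₀ hs; linarith,
            inv_pos.2 hspos, by ring, ?_⟩
          rw [smul_add, smul_smul, smul_smul, ← add_assoc, ← add_smul, inv_mul_cancel₀ hspos.ne',
            mul_sub, inv_mul_cancel₀ hspos.ne']
          simp
        exact hwy (hy.2 hw.1 hzP hmem)
      exact ⟨1 - s, s, by linarith, hs0, by ring, by simp⟩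
  · rw [← convexHull_pair, affineSpan_convexHull, direction_affineSpan,
      vectorSpan_pair_rev]
    refine finrank_span_singleton ?_
    simp [sub_eq_zero, hwy.symm]
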